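/- Let F, G, H, K : (0,1) → ℝ be continuous functions satisfying F(x) + G(y/(1-x)) = H(y) + K(x/(1-y)) for all x, y ∈ (0,1) with x + y ∈ (0,1). Then there exist real constants κ₁, κ₂, κ₃, C₁, C₂, C₃, C₄ with C₁ + C₂ = C₃ + C₄ such that for all x ∈ (0,1): F(x) = κ₁ log(1-x) + κ₂ log x + κ₃ log(1-x) + C₁, G(x) = κ₁ log(1-x) + κ₃ log x + C₂, H(x) = κ₁ log(1-x) + κ₂ log(1-x) + κ₃ log x + C₃, K(x) = κ₁ log(1-x) + κ₂ log x + C₄. -/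

import Mathlib

open Set

/-- The fundamental equation of information with four unknown functions on `(0,1)`. -/
def SatisfiesInformationEquation (F G H K : ℝ → ℝ) : Prop :=
  ∀ x ∈ Ioo (0 : ℝ) 1, ∀ y ∈ Ioo (0 : ℝ) 1, x + y ∈ Ioo (0 : ℝ) 1 →
    F x + G (y / (1 - x)) = H y + K (x / (1 - y))

lemma eq_of_hasDerivAt_zero_on_Ioo {f : ℝ → ℝ} {a b : ℝ}
    (hf : ∀ x ∈ Ioo a b, HasDerivAt f 0 x) {x y : ℝ} (hx : x ∈ Ioo a b) (hy : y ∈ Ioo a b) :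
    f x = f y :=
  isOpen_Ioo.is_const_of_deriv_eq_zero isPreconnected_Ioo
    (fun z hz => (hf z hz).differentiableAt.differentiableWithinAt)
    (fun z hz => (hf z hz).deriv) hx hy

lemma exists_hasDerivAt_on_Ioo {f : ℝ → ℝ} {a b : ℝ} (hf : ContinuousOn f (Ioo a b)) :
    ∃ Φ : ℝ → ℝ, ∀ z ∈ Ioo a b, HasDerivAt Φ (f z) z := by
  rcases (Ioo a b).eq_empty_or_nonempty with h | ⟨c, hc⟩
  · exact ⟨f, by simp [h]⟩
  · refine ⟨fun z => ∫ t in c..z, f t, fun z hz => ?_⟩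
    have hsub : uIcc c z ⊆ Ioo a b := ordConnected_Ioo.uIcc_subset hc hz
    exact intervalIntegral.integral_hasDerivAt_right (hf.mono hsub).intervalIntegrable
      (hf.stronglyMeasurableAtFilter isOpen_Ioo z hz) (hf.continuousAt (isOpen_Ioo.mem_nhds hz))

lemma contDiffOn_succ_of_hasDerivAt {f Φ : ℝ → ℝ} {s : Set ℝ} (hs : IsOpen s) {n : ℕ}
    (hf : ContDiffOn ℝ n f s) (hΦ : ∀ z ∈ s, HasDerivAt Φ (f z) z) :
    ContDiffOn ℝ (n + 1) Φ s := by
  rw [contDiffOn_succ_iff_deriv_of_isOpen hs]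
  refine ⟨fun z hz => (hΦ z hz).differentiableAt.differentiableWithinAt, by simp, ?_⟩
  exact hf.congr fun z hz => (hΦ z hz).deriv

lemma div_one_sub_mem_Ioo {x y : ℝ} (hy : 0 < y) (hxy : x + y < 1) :
    y / (1 - x) ∈ Ioo (0 : ℝ) 1 :=
  ⟨div_pos hy (by linarith), (div_lt_one (by linarith)).2 (by linarith)⟩

lemma mul_one_sub_div_mem_Ioo {p q : ℝ} (hp : p ∈ Ioo (0 : ℝ) 1) (hq : q ∈ Ioo (0 : ℝ) 1) :
    q * (1 - p) / (1 - p * q) ∈ Ioo (0 : ℝ) 1 := by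
  obtain ⟨hp0, hp1⟩ := hp
  obtain ⟨hq0, hq1⟩ := hq
  have h : 0 < 1 - p * q := by nlinarith
  exact ⟨div_pos (mul_pos hq0 (by linarith)) h, (div_lt_one h).2 (by linarith)⟩

lemma differentiableAt_mul_deriv {f : ℝ → ℝ} (hf : ContDiffOn ℝ 2 f (Ioo 0 1)) {z : ℝ}
    (hz : z ∈ Ioo (0 : ℝ) 1) : DifferentiableAt ℝ (fun x => x * (1 - x) * deriv f x) z := by
  have : ContDiffOn ℝ (1 + 1) f (Ioo 0 1) := by rwa [one_add_one_eq_two]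
  have hd := ((contDiffOn_succ_iff_deriv_of_isOpen isOpen_Ioo).1 this).2.2
  have hd' := (hd.differentiableOn one_ne_zero).differentiableAt (isOpen_Ioo.mem_nhds hz)
  fun_prop

lemma eq_log_of_mul_deriv_eq {f : ℝ → ℝ} {α β : ℝ} (hf : DifferentiableOn ℝ f (Ioo 0 1))
    (h : ∀ x ∈ Ioo (0 : ℝ) 1, x * (1 - x) * deriv f x = α * x + β) :
    ∃ C, ∀ x ∈ Ioo (0 : ℝ) 1,
      f x = β * Real.log x - (α + β) * Real.log (1 - x) + C := by
  set g := fun x => f x - β * Real.log x + (α + β) * Real.log (1 - x) with hg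
  refine ⟨g (1 / 2), fun x hx => ?_⟩
  have := eq_of_hasDerivAt_zero_on_Ioo (f := g) (a := 0) (b := 1) (fun z hz => by
    have hz0 : z ≠ 0 := hz.1.ne'
    have hz1 : 1 - z ≠ 0 := by linarith [hz.2]
    have d := (((hf.differentiableAt (isOpen_Ioo.mem_nhds hz)).hasDerivAt).sub
      ((Real.hasDerivAt_log hz0).const_mul β)).add
      ((((hasDerivAt_id z).const_sub 1).log hz1).const_mul (α + β))
    refine d.congr_deriv ?_
    have := h z hz
    simp only [id]
    field_simp
    linarith) hx (y := 1 / 2) (by norm_num)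
  rw [← this]
  simp only [hg]
  ring

namespace SatisfiesInformationEquation

variable {F G H K : ℝ → ℝ}

lemma symm (h : SatisfiesInformationEquation F G H K) :
    SatisfiesInformationEquation H K F G :=
  fun x hx y hy hxy => (h y hy x hx (add_comm x y ▸ hxy)).symm

/-- The equation in the coordinates `p = y / (1 - x)`, `q = x / (1 - y)`. -/
lemma eq_of_mem (h : SatisfiesInformationEquation F G H K) {p q : ℝ}
    (hp : p ∈ Ioo (0 : ℝ) 1) (hq : q ∈ Ioo (0 : ℝ) 1) :
    F (q * (1 - p) / (1 - p * q)) + G p = H (p * (1 - q) / (1 - q * p)) + K q := by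
  have hX := mul_one_sub_div_mem_Ioo hp hq
  have hY := mul_one_sub_div_mem_Ioo hq hp
  obtain ⟨hp0, hp1⟩ := hp
  obtain ⟨hq0, hq1⟩ := hq
  have h0 : 0 < 1 - p * q := by nlinarith
  have hp' : 1 - p ≠ 0 := by linarith
  have hq' : 1 - q ≠ 0 := by linarith
  have h0' : 1 - q * p ≠ 0 := by rw [mul_comm]; exact h0.ne'
  have eX : 1 - q * (1 - p) / (1 - p * q) = (1 - q) / (1 - p * q) := by
    field_simp; ring
  have eY : 1 - p * (1 - q) / (1 - q * p) = (1 - p) / (1 - p * q) := by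
    rw [mul_comm q p]; field_simp; ring
  have hsum : q * (1 - p) / (1 - p * q) + p * (1 - q) / (1 - q * p) < 1 := by
    have : 0 < (1 - p) * (1 - q) / (1 - p * q) :=
      div_pos (mul_pos (by linarith) (by linarith)) h0
    have e : 1 - (q * (1 - p) / (1 - p * q) + p * (1 - q) / (1 - q * p)) =
        (1 - p) * (1 - q) / (1 - p * q) := by
      rw [mul_comm q p]; field_simp; ring
    linarith
  have key := h _ hX _ hY ⟨add_pos hX.1 hY.1, hsum⟩
  have e1 : p * (1 - q) / (1 - q * p) / (1 - q * (1 - p) / (1 - p * q)) = p := by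
    rw [eX, mul_comm q p]; field_simp
  have e2 : q * (1 - p) / (1 - p * q) / (1 - p * (1 - q) / (1 - q * p)) = q := by
    rw [eY]; field_simp
  rwa [e1, e2] at key

lemma contDiffOn_succ_left (h : SatisfiesInformationEquation F G H K) {n : ℕ}
    (hG : ContDiffOn ℝ n G (Ioo 0 1)) (hH : ContinuousOn H (Ioo 0 1))
    (hK : ContDiffOn ℝ n K (Ioo 0 1)) : ContDiffOn ℝ (n + 1) F (Ioo 0 1) := by
  have hL : ContDiffOn ℝ n (fun z => K z / z ^ 2) (Ioo 0 1) :=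
    hK.div (contDiffOn_id.pow 2) fun z hz => pow_ne_zero 2 hz.1.ne'
  obtain ⟨Γ, hΓ⟩ := exists_hasDerivAt_on_Ioo hG.continuousOn
  obtain ⟨Η, hΗ⟩ := exists_hasDerivAt_on_Ioo hH
  obtain ⟨Λ, hΛ⟩ := exists_hasDerivAt_on_Ioo hL.continuousOn
  have cΓ := contDiffOn_succ_of_hasDerivAt isOpen_Ioo hG hΓ
  have cΛ := contDiffOn_succ_of_hasDerivAt isOpen_Ioo hL hΛ
  have key : ∀ a b x : ℝ, 0 < a → a < b → 0 < x → x + b < 1 →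
      F x = ((Η b - Η a) + x * (Λ (x / (1 - b)) - Λ (x / (1 - a)))
        - (1 - x) * (Γ (b / (1 - x)) - Γ (a / (1 - x)))) / (b - a) := by
    intro a b x ha hab hx hxb
    have hd : ∀ y ∈ Ioo 0 (1 - x), HasDerivAt (fun y => F x * y + (1 - x) * Γ (y / (1 - x))
        - Η y - x * Λ (x / (1 - y))) 0 y := by
      intro y hy
      have hy0 := hy.1
      have hy1 := hy.2
      have hx1 : 1 - x ≠ 0 := by linarith
      have hy1' : 1 - y ≠ 0 := by linarith
      have d1 : HasDerivAt (fun y => Γ (y / (1 - x))) (G (y / (1 - x)) * (1 / (1 - x))) y :=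
        (hΓ _ (div_one_sub_mem_Ioo hy0 (by linarith))).comp y
          ((hasDerivAt_id y).div_const (1 - x))
      have d2 : HasDerivAt (fun y => x / (1 - y)) (x / (1 - y) ^ 2) y := by
        have := (hasDerivAt_const y x).div ((hasDerivAt_id y).const_sub 1) hy1'
        refine this.congr_deriv ?_
        simp
      have d3 := (hΛ _ (div_one_sub_mem_Ioo hx (by linarith))).comp y d2
      have d4 := ((((hasDerivAt_id y).const_mul (F x)).add (d1.const_mul (1 - x))).sub
        (hΗ y ⟨hy0, by linarith⟩)).sub (d3.const_mul x)
      refine d4.congr_deriv ?_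
      have e := h x ⟨hx, by linarith⟩ y ⟨hy0, by linarith⟩ ⟨by linarith, by linarith⟩
      have e' : F x = H y + K (x / (1 - y)) - G (y / (1 - x)) := by linarith
      rw [e']
      field_simp
      ring
    have e := eq_of_hasDerivAt_zero_on_Ioo hd (x := a) (y := b) ⟨ha, by linarith⟩
      ⟨by linarith, by linarith⟩
    rw [eq_div_iff (by linarith)]
    linarith
  intro x₀ hx₀
  refine ContDiffAt.contDiffWithinAt ?_
  obtain ⟨h0, h1⟩ := hx₀
  set a := (1 - x₀) / 3 with ha
  set b := (1 - x₀) / 2 with hb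
  have hx1 : 1 - x₀ ≠ 0 := by linarith
  have ha1 : 1 - a ≠ 0 := by linarith
  have hb1 : 1 - b ≠ 0 := by linarith
  have hev : F =ᶠ[nhds x₀] fun x => ((Η b - Η a) + x * (Λ (x / (1 - b)) - Λ (x / (1 - a)))
        - (1 - x) * (Γ (b / (1 - x)) - Γ (a / (1 - x)))) / (b - a) := by
    filter_upwards [Ioo_mem_nhds h0 (show x₀ < 1 - b by linarith)] with x hx
    exact key a b x (by linarith) (by linarith) hx.1 (by linarith [hx.2])
  refine ContDiffAt.congr_of_eventuallyEq ?_ hev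
  have cΛ' : ∀ c, 0 < c → x₀ + c < 1 →
      ContDiffAt ℝ (n + 1) (fun x => Λ (x / (1 - c))) x₀ := fun c hc hc1 =>
    ContDiffAt.comp x₀ (cΛ.contDiffAt
      (isOpen_Ioo.mem_nhds (div_one_sub_mem_Ioo h0 (by linarith))))
      (contDiffAt_id.div_const _)
  have cΓ' : ∀ c, 0 < c → x₀ + c < 1 →
      ContDiffAt ℝ (n + 1) (fun x => Γ (c / (1 - x))) x₀ := fun c hc hc1 =>
    ContDiffAt.comp x₀ (cΓ.contDiffAt
      (isOpen_Ioo.mem_nhds (div_one_sub_mem_Ioo hc hc1)))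
      (contDiffAt_const.div (contDiffAt_const.sub contDiffAt_id) hx1)
  have pa : 0 < a := by linarith
  have pb : 0 < b := by linarith
  exact ((contDiffAt_const.add (contDiffAt_id.mul
    ((cΛ' b pb (by linarith)).sub (cΛ' a pa (by linarith))))).sub
    ((contDiffAt_const.sub contDiffAt_id).mul
      ((cΓ' b pb (by linarith)).sub (cΓ' a pa (by linarith))))).div_const _

lemma contDiffOn_right (h : SatisfiesInformationEquation F G H K) {n : ℕ}
    (hF : ContDiffOn ℝ n F (Ioo 0 1)) (hH : ContDiffOn ℝ n H (Ioo 0 1)) :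
    ContDiffOn ℝ n K (Ioo 0 1) := by
  have hp : (1 / 2 : ℝ) ∈ Ioo (0 : ℝ) 1 := by norm_num
  have cX : ContDiffOn ℝ n (fun q : ℝ => q * (1 - 1 / 2) / (1 - 1 / 2 * q)) (Ioo 0 1) :=
    (contDiffOn_id.mul contDiffOn_const).div
      (contDiffOn_const.sub (contDiffOn_const.mul contDiffOn_id))
      fun q hq => by linarith [hq.1, hq.2]
  have cY : ContDiffOn ℝ n (fun q : ℝ => 1 / 2 * (1 - q) / (1 - q * (1 / 2))) (Ioo 0 1) :=
    (contDiffOn_const.mul (contDiffOn_const.sub contDiffOn_id)).div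
      (contDiffOn_const.sub (contDiffOn_id.mul contDiffOn_const))
      fun q hq => by linarith [hq.1, hq.2]
  refine (((hF.comp cX fun q hq => mul_one_sub_div_mem_Ioo hp hq).sub
    (hH.comp cY fun q hq => mul_one_sub_div_mem_Ioo hq hp)).add
    (contDiffOn_const (c := G (1 / 2)))).congr fun q hq => ?_
  have := h.eq_of_mem hp hq
  simp only [Function.comp]
  linarith

lemma contDiffOn_of_continuousOn (h : SatisfiesInformationEquation F G H K)
    (hF : ContinuousOn F (Ioo 0 1)) (hG : ContinuousOn G (Ioo 0 1))
    (hH : ContinuousOn H (Ioo 0 1)) (hK : ContinuousOn K (Ioo 0 1)) (n : ℕ) :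
    ContDiffOn ℝ n F (Ioo 0 1) ∧ ContDiffOn ℝ n G (Ioo 0 1) ∧
      ContDiffOn ℝ n H (Ioo 0 1) ∧ ContDiffOn ℝ n K (Ioo 0 1) := by
  induction n with
  | zero => simp [contDiffOn_zero, hF, hG, hH, hK]
  | succ n ih =>
    obtain ⟨-, iG, -, iK⟩ := ih
    have cF : ContDiffOn ℝ (n + 1 : ℕ) F (Ioo 0 1) := by
      simpa using h.contDiffOn_succ_left iG hH iK
    have cH : ContDiffOn ℝ (n + 1 : ℕ) H (Ioo 0 1) := by
      simpa using h.symm.contDiffOn_succ_left iK hF iG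
    exact ⟨cF, h.symm.contDiffOn_right cH cF, cH, h.contDiffOn_right cF cH⟩

lemma hasDerivAt_coord_right {p q : ℝ} (h : 1 - p * q ≠ 0) :
    HasDerivAt (fun q => q * (1 - p) / (1 - p * q)) ((1 - p) / (1 - p * q) ^ 2) q := by
  refine (((hasDerivAt_id q).mul_const (1 - p)).div
    (((hasDerivAt_id q).const_mul p).const_sub 1) h).congr_deriv ?_
  simp only [id]
  ring

lemma hasDerivAt_coord_left {p q : ℝ} (h : 1 - q * p ≠ 0) :
    HasDerivAt (fun q => p * (1 - q) / (1 - q * p)) (-(p * (1 - p)) / (1 - q * p) ^ 2) q := by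
  refine ((((hasDerivAt_id q).const_sub 1).const_mul p).div
    (((hasDerivAt_id q).mul_const p).const_sub 1) h).congr_deriv ?_
  simp only [id]
  ring

/-- Differentiating the equation in `q` at fixed `p`. -/
lemma mul_deriv_add_mul_deriv (h : SatisfiesInformationEquation F G H K)
    (hF : DifferentiableOn ℝ F (Ioo 0 1)) (hH : DifferentiableOn ℝ H (Ioo 0 1)) {p q : ℝ}
    (hp : p ∈ Ioo (0 : ℝ) 1) (hq : q ∈ Ioo (0 : ℝ) 1) {x y : ℝ}
    (hx : x = q * (1 - p) / (1 - p * q)) (hy : y = p * (1 - q) / (1 - q * p)) :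
    x * (1 - x) * deriv F x + q * (y * (1 - y) * deriv H y) = q * (1 - q) * deriv K q := by
  have hX := mul_one_sub_div_mem_Ioo hp hq
  have hY := mul_one_sub_div_mem_Ioo hq hp
  have h0 : 1 - p * q ≠ 0 := by nlinarith [hp.1, hp.2, hq.1, hq.2]
  have h0' : 1 - q * p ≠ 0 := by rwa [mul_comm]
  have dF := ((hF.differentiableAt (isOpen_Ioo.mem_nhds hX)).hasDerivAt).comp q
    (hasDerivAt_coord_right h0)
  have dH := ((hH.differentiableAt (isOpen_Ioo.mem_nhds hY)).hasDerivAt).comp q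
    (hasDerivAt_coord_left h0')
  have dK := ((dF.sub dH).add_const (G p)).congr_of_eventuallyEq (f₁ := K) (by
    filter_upwards [isOpen_Ioo.mem_nhds hq] with q hq
    have := h.eq_of_mem hp hq
    simp only [Function.comp, Pi.sub_apply]
    linarith)
  rw [dK.deriv, ← hx, ← hy]
  generalize deriv F x = A
  generalize deriv H y = B
  rw [hx, hy, mul_comm q p]
  field_simp
  ring

lemma deriv_eq_deriv (h : SatisfiesInformationEquation F G H K)
    (hF : ContDiffOn ℝ 2 F (Ioo 0 1)) (hH : ContDiffOn ℝ 2 H (Ioo 0 1)) {x y : ℝ}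
    (hx : 0 < x) (hy : 0 < y) (hxy : x + y < 1) :
    deriv (fun x => x * (1 - x) * deriv F x) x = deriv (fun y => y * (1 - y) * deriv H y) y := by
  have hx1 : 0 < 1 - x := by linarith
  have hy1 : 0 < 1 - y := by linarith
  have hp := div_one_sub_mem_Ioo hy hxy
  have hq := div_one_sub_mem_Ioo hx (by linarith)
  set p := y / (1 - x)
  set q := x / (1 - y)
  have h0 : 1 - p * q ≠ 0 := by nlinarith [hp.1, hp.2, hq.1, hq.2]
  have h0' : 1 - q * p ≠ 0 := by rwa [mul_comm]
  have ep : p * (1 - x) = y := div_mul_cancel₀ y hx1.ne'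
  have eq : q * (1 - y) = x := div_mul_cancel₀ x hy1.ne'
  have eX : q * (1 - p) / (1 - p * q) = x := by
    rw [div_eq_iff h0]; linear_combination eq - q * ep
  have eY : p * (1 - q) / (1 - q * p) = y := by
    rw [div_eq_iff h0']; linear_combination ep - p * eq
  set A := fun x => x * (1 - x) * deriv F x
  set B := fun y => y * (1 - y) * deriv H y
  have dA : HasDerivAt (fun p => A (q * (1 - p) / (1 - p * q)))
      (deriv A x * (-(q * (1 - q)) / (1 - p * q) ^ 2)) p := by
    rw [← eX]
    exact (differentiableAt_mul_deriv hF (mul_one_sub_div_mem_Ioo hp hq)).hasDerivAt.comp p (hasDerivAt_coord_left h0)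
  have dB : HasDerivAt (fun p => B (p * (1 - q) / (1 - q * p)))
      (deriv B y * ((1 - q) / (1 - q * p) ^ 2)) p := by
    rw [← eY]
    exact (differentiableAt_mul_deriv hH (mul_one_sub_div_mem_Ioo hq hp)).hasDerivAt.comp p (hasDerivAt_coord_right h0')
  have dC := (hasDerivAt_const p (q * (1 - q) * deriv K q)).congr_of_eventuallyEq
    (f₁ := fun p => A (q * (1 - p) / (1 - p * q)) + q * B (p * (1 - q) / (1 - q * p))) (by
      filter_upwards [isOpen_Ioo.mem_nhds hp] with p hp
      exact h.mul_deriv_add_mul_deriv (hF.differentiableOn two_ne_zero)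
        (hH.differentiableOn two_ne_zero) hp hq rfl rfl)
  have e := (dA.add (dB.const_mul q)).unique dC
  have hq0 := hq.1.ne'
  have hq1 : 1 - q ≠ 0 := by linarith [hq.2]
  rw [mul_comm q p] at e
  field_simp at e
  exact mul_left_cancel₀ (mul_ne_zero hq0 hq1) (by linear_combination -e)

lemma exists_mul_deriv_eq (h : SatisfiesInformationEquation F G H K)
    (hF : ContDiffOn ℝ 2 F (Ioo 0 1)) (hH : ContDiffOn ℝ 2 H (Ioo 0 1)) :
    ∃ α β γ : ℝ, (∀ x ∈ Ioo (0 : ℝ) 1, x * (1 - x) * deriv F x = α * x + β) ∧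
      ∀ y ∈ Ioo (0 : ℝ) 1, y * (1 - y) * deriv H y = α * y + γ := by
  set A := fun x => x * (1 - x) * deriv F x
  set B := fun y => y * (1 - y) * deriv H y
  have hAB : ∀ {x y : ℝ}, 0 < x → 0 < y → x + y < 1 → deriv A x = deriv B y :=
    fun hx hy hxy => h.deriv_eq_deriv hF hH hx hy hxy
  have affine : ∀ {f : ℝ → ℝ} {α : ℝ}, ContDiffOn ℝ 2 f (Ioo 0 1) →
      (∀ z ∈ Ioo (0 : ℝ) 1, deriv (fun x => x * (1 - x) * deriv f x) z = α) →
      ∃ β, ∀ x ∈ Ioo (0 : ℝ) 1, x * (1 - x) * deriv f x = α * x + β := by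
    intro f α hf hα
    refine ⟨1 / 2 * (1 - 1 / 2) * deriv f (1 / 2) - α * (1 / 2), fun x hx => ?_⟩
    have := eq_of_hasDerivAt_zero_on_Ioo (f := fun x => x * (1 - x) * deriv f x - α * x)
      (a := 0) (b := 1) (fun z hz => by
        have d := (differentiableAt_mul_deriv hf hz).hasDerivAt.sub
          ((hasDerivAt_id z).const_mul α)
        rw [hα z hz] at d
        exact d.congr_deriv (by ring)) hx (y := 1 / 2) (by norm_num)
    linarith
  have hA' : ∀ z ∈ Ioo (0 : ℝ) 1, deriv A z = deriv A (1 / 2) := by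
    intro z hz
    have hy : 0 < min (1 - z) (1 / 2) / 2 := by
      have := hz.2
      have : 0 < min (1 - z) (1 / 2) := lt_min (by linarith) (by norm_num)
      linarith
    have h1 := min_le_left (1 - z) (1 / 2)
    have h2 := min_le_right (1 - z) (1 / 2)
    rw [hAB hz.1 hy (by linarith), hAB (x := 1 / 2) (by norm_num) hy (by linarith)]
  have hB' : ∀ z ∈ Ioo (0 : ℝ) 1, deriv B z = deriv A (1 / 2) := by
    intro z hz
    have hz1 := hz.2
    rw [← hA' ((1 - z) / 2) ⟨by linarith, by linarith [hz.1]⟩]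
    exact (hAB (by linarith) hz.1 (by linarith)).symm
  obtain ⟨β, hβ⟩ := affine hF hA'
  obtain ⟨γ, hγ⟩ := affine hH hB'
  exact ⟨_, β, γ, hβ, hγ⟩

end SatisfiesInformationEquation


/-- Continuous solution of the fundamental equation of information with four
unknown functions on `(0,1)`. -/
theorem fundamental_equation_of_information_dim_one
    (F G H K : ℝ → ℝ)
    (hF : ContinuousOn F (Set.Ioo 0 1)) (hG : ContinuousOn G (Set.Ioo 0 1))
    (hH : ContinuousOn H (Set.Ioo 0 1)) (hK : ContinuousOn K (Set.Ioo 0 1))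
    (heq : ∀ x ∈ Set.Ioo (0:ℝ) 1, ∀ y ∈ Set.Ioo (0:ℝ) 1, x + y ∈ Set.Ioo (0:ℝ) 1 →
      F x + G (y / (1 - x)) = H y + K (x / (1 - y))) :
    ∃ κ₁ κ₂ κ₃ C₁ C₂ C₃ C₄ : ℝ, C₁ + C₂ = C₃ + C₄ ∧
      ∀ x ∈ Set.Ioo (0:ℝ) 1,
        F x = κ₁ * Real.log (1 - x) + κ₂ * Real.log x + κ₃ * Real.log (1 - x) + C₁ ∧
        G x = κ₁ * Real.log (1 - x) + κ₃ * Real.log x + C₂ ∧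
        H x = κ₁ * Real.log (1 - x) + κ₂ * Real.log (1 - x) + κ₃ * Real.log x + C₃ ∧
        K x = κ₁ * Real.log (1 - x) + κ₂ * Real.log x + C₄ := by
  have h : SatisfiesInformationEquation F G H K := heq
  obtain ⟨cF, -, cH, -⟩ := h.contDiffOn_of_continuousOn hF hG hH hK 2
  obtain ⟨α, β, γ, hα, hγ⟩ := h.exists_mul_deriv_eq cF cH
  obtain ⟨C₁, hC₁⟩ := eq_log_of_mul_deriv_eq (cF.differentiableOn two_ne_zero) hα
  obtain ⟨C₃, hC₃⟩ := eq_log_of_mul_deriv_eq (cH.differentiableOn two_ne_zero) hγ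
  have key : ∀ p ∈ Set.Ioo (0 : ℝ) 1, ∀ q ∈ Set.Ioo (0 : ℝ) 1,
      C₁ + (G p + (α + β + γ) * Real.log (1 - p) - γ * Real.log p) =
        C₃ + (K q + (α + β + γ) * Real.log (1 - q) - β * Real.log q) := by
    intro p hp q hq
    have hX := mul_one_sub_div_mem_Ioo hp hq
    have hY := mul_one_sub_div_mem_Ioo hq hp
    have e := h.eq_of_mem hp hq
    rw [hC₁ _ hX, hC₃ _ hY] at e
    have hp0 := hp.1.ne'
    have hq0 := hq.1.ne'
    have hp1 : 1 - p ≠ 0 := by linarith [hp.2]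
    have hq1 : 1 - q ≠ 0 := by linarith [hq.2]
    have h0 : 1 - p * q ≠ 0 := by nlinarith [hp.1, hp.2, hq.1, hq.2]
    have eX : 1 - q * (1 - p) / (1 - p * q) = (1 - q) / (1 - p * q) := by
      rw [eq_div_iff h0, sub_mul, div_mul_cancel₀ _ h0]; ring
    have eY : 1 - p * (1 - q) / (1 - p * q) = (1 - p) / (1 - p * q) := by
      rw [eq_div_iff h0, sub_mul, div_mul_cancel₀ _ h0]; ring
    rw [mul_comm q p, eX, eY, Real.log_div (mul_ne_zero hq0 hp1) h0,
      Real.log_div (mul_ne_zero hp0 hq1) h0, Real.log_div hp1 h0, Real.log_div hq1 h0,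
      Real.log_mul hq0 hp1, Real.log_mul hp0 hq1] at e
    linear_combination e
  have hm : (1 / 2 : ℝ) ∈ Set.Ioo (0 : ℝ) 1 := by norm_num
  refine ⟨-(α + β + γ), β, γ, C₁,
    G (1 / 2) + (α + β + γ) * Real.log (1 - 1 / 2) - γ * Real.log (1 / 2), C₃,
    K (1 / 2) + (α + β + γ) * Real.log (1 - 1 / 2) - β * Real.log (1 / 2), key _ hm _ hm,
    fun x hx => ⟨?_, ?_, ?_, ?_⟩⟩
  · rw [hC₁ x hx]; ring
  · linear_combination key x hx _ hm - key _ hm _ hm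
  · rw [hC₃ x hx]; ring
  · linear_combination key _ hm _ hm - key _ hm x hx
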